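/- arXiv:2004.04586 — 3 statements merged into one kernel-verified Lean document; each statement's English description precedes it below -/
import Mathlib

section
/- Let v = branch ℓ z o be an ordered ZDD node and S a finite set of naturals. Then S ∈ F(v) if and only if either (ℓ ∈ S and S \ {ℓ} ∈ F(o)) or (ℓ ∉ S and S ∈ F(z)). -/
inductive Z : Type
  | bot : Z
  | top : Z
  | branch (ℓ : ℕ) (z o : Z) : Z

open Z

/-- The set family of finite sets of naturals represented by a ZDD node. -/
def F : Z → Finset (Finset ℕ)
  | bot => ∅
  | top => {∅}
  | branch ℓ z o => (F o).image (fun S => S ∪ {ℓ}) ∪ F z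

/-- The labels occurring in a ZDD node. -/
def labels : Z → Finset ℕ
  | bot => ∅
  | top => ∅
  | branch ℓ z o => insert ℓ (labels z ∪ labels o)

/-- A ZDD node is ordered if labels strictly increase along every
root-to-terminal path. -/
def Ordered : Z → Prop
  | bot => True
  | top => True
  | branch ℓ z o =>
      (∀ m ∈ labels z, ℓ < m) ∧ (∀ m ∈ labels o, ℓ < m) ∧ Ordered z ∧ Ordered o

theorem subset_labels_of_mem_F {v : Z} {S : Finset ℕ} (hS : S ∈ F v) : S ⊆ labels v := by
  induction v generalizing S with
  | bot => simp [F] at hS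
  | top => simp_all [F]
  | branch ℓ z o ihz iho =>
    simp only [F, Finset.mem_union, Finset.mem_image] at hS
    intro x hx
    simp only [labels, Finset.mem_insert, Finset.mem_union]
    rcases hS with ⟨T, hT, rfl⟩ | hS
    · rcases Finset.mem_union.mp hx with hx | hx
      · exact .inr (.inr (iho hT hx))
      · exact .inl (Finset.mem_singleton.mp hx)
    · exact .inr (.inl (ihz hS hx))

theorem stmt_2 (ℓ : ℕ) (z o : Z) (h : Ordered (Z.branch ℓ z o)) (S : Finset ℕ) :
    S ∈ F (Z.branch ℓ z o) ↔
      (ℓ ∈ S ∧ S \ {ℓ} ∈ F o) ∨ (ℓ ∉ S ∧ S ∈ F z) := by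
  obtain ⟨hz, ho, -, -⟩ := h
  have hnz {T : Finset ℕ} (hT : T ∈ F z) : ℓ ∉ T := fun hl =>
    (hz ℓ (subset_labels_of_mem_F hT hl)).false
  have hno {T : Finset ℕ} (hT : T ∈ F o) : ℓ ∉ T := fun hl =>
    (ho ℓ (subset_labels_of_mem_F hT hl)).false
  simp only [F, Finset.mem_union, Finset.mem_image]
  constructor
  · rintro (⟨T, hT, rfl⟩ | hS)
    · refine .inl ⟨by simp, ?_⟩
      rwa [Finset.union_sdiff_cancel_right (Finset.disjoint_singleton_right.mpr (hno hT))]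
    · exact .inr ⟨hnz hS, hS⟩
  · rintro (⟨hl, hS⟩ | ⟨-, hS⟩)
    · exact .inl ⟨_, hS, Finset.sdiff_union_of_subset (Finset.singleton_subset_iff.mpr hl)⟩
    · exact .inr hS
end

section
/- For every ordered ZDD node v and every finite set S of naturals, the membership traversal succeeds exactly for members of the represented family: eval(v, S) = true if and only if S ∈ F(v). -/
open Z

/-- Membership traversal on a ZDD. -/
def eval : Z → Finset ℕ → Bool
  | Z.bot, _ => false
  | Z.top, S => S = ∅
  | Z.branch ℓ z o, S => if ℓ ∈ S then eval o (S \ {ℓ}) else eval z S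

theorem stmt_4 (v : Z) (h : Ordered v) (S : Finset ℕ) :
    eval v S = true ↔ S ∈ F v := by
  induction v generalizing S with
  | bot => simp [eval, F]
  | top => simp [eval, F]
  | branch ℓ z o ihz iho =>
    obtain ⟨hz, ho, hoz, hoo⟩ := h
    have not_mem_z : ∀ T ∈ F z, ℓ ∉ T := fun T hT hl =>
      lt_irrefl _ (hz ℓ (subset_labels_of_mem_F hT hl))
    have not_mem_o : ∀ T ∈ F o, ℓ ∉ T := fun T hT hl =>
      lt_irrefl _ (ho ℓ (subset_labels_of_mem_F hT hl))
    simp only [eval, F, Finset.mem_union, Finset.mem_image]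
    split_ifs with hl
    · rw [iho hoo]
      constructor
      · intro hS
        exact Or.inl ⟨_, hS, Finset.sdiff_union_of_subset (Finset.singleton_subset_iff.2 hl)⟩
      · rintro (⟨T, hT, rfl⟩ | hS)
        · rwa [Finset.union_sdiff_cancel_right
            (Finset.disjoint_singleton_right.2 (not_mem_o T hT))]
        · exact absurd hl (not_mem_z S hS)
    · rw [ihz hoz]
      refine ⟨Or.inr, ?_⟩
      rintro (⟨T, -, rfl⟩ | hS)
      · simp at hl
      · exact hS
end

section
/- For every ordered ZDD node v, the map sending an accepting bit-string b to onesLabels(v, b) is a bijection from the set of bit-strings b with run(v, b) = true onto the family F(v). In other words, the paths from v to the terminal top are in one-to-one correspondence with the sets of the family represented by v. -/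
open Z

/-- Running a bit-string path from a ZDD node; true iff the path ends at top. -/
def run : Z → List Bool → Bool
  | Z.top, [] => true
  | Z.bot, _ => false
  | Z.branch _ z _, false :: b => run z b
  | Z.branch _ _ o, true :: b => run o b
  | Z.top, _ :: _ => false
  | Z.branch _ _ _, [] => false

/-- The labels of branching nodes along path b at which the 1-edge is taken. -/
def onesLabels : Z → List Bool → Finset ℕ
  | Z.branch _ z _, false :: b => onesLabels z b
  | Z.branch ℓ _ o, true :: b => {ℓ} ∪ onesLabels o b
  | _, _ => ∅

theorem onesLabels_subset_labels (v : Z) (b : List Bool) : onesLabels v b ⊆ labels v := by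
  induction v generalizing b with
  | bot => simp [onesLabels]
  | top => simp [onesLabels]
  | branch ℓ z o ihz iho =>
    rcases b with _ | ⟨_ | _, b⟩
    · simp [onesLabels]
    · exact (ihz b).trans fun m hm => by simp [labels, hm]
    · intro m hm
      simp only [onesLabels, Finset.mem_union, Finset.mem_singleton] at hm
      rcases hm with rfl | hm
      · simp [labels]
      · simp [labels, iho b hm]

theorem mem_F_iff (v : Z) (S : Finset ℕ) :
    S ∈ F v ↔ ∃ b, run v b = true ∧ onesLabels v b = S := by
  induction v generalizing S with
  | bot => simp [F, run]
  | top =>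
    simp only [F, Finset.mem_singleton]
    constructor
    · rintro rfl
      exact ⟨[], rfl, rfl⟩
    · rintro ⟨b, -, rfl⟩
      simp [onesLabels]
  | branch ℓ z o ihz iho =>
    simp only [F, Finset.mem_union, Finset.mem_image, ihz, iho]
    constructor
    · rintro (⟨_, ⟨b, hb, rfl⟩, rfl⟩ | ⟨b, hb, rfl⟩)
      · exact ⟨true :: b, hb, Finset.union_comm _ _⟩
      · exact ⟨false :: b, hb, rfl⟩
    · rintro ⟨_ | ⟨_ | _, b⟩, hb, rfl⟩
      · simp [run] at hb
      · exact Or.inr ⟨b, hb, rfl⟩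
      · exact Or.inl ⟨_, ⟨b, hb, rfl⟩, Finset.union_comm _ _⟩

theorem onesLabels_injOn (v : Z) (h : Ordered v) :
    Set.InjOn (onesLabels v) {b | run v b = true} := by
  induction v with
  | bot => simp [run]
  | top =>
    rintro (_ | ⟨_, _⟩) hb (_ | ⟨_, _⟩) hc - <;> simp_all [run]
  | branch ℓ z o ihz iho =>
    obtain ⟨hz, ho, oz, oo⟩ := h
    have notMem_z (b : List Bool) : ℓ ∉ onesLabels z b := fun hm =>
      lt_irrefl _ (hz _ (onesLabels_subset_labels z b hm))
    have notMem_o (b : List Bool) : ℓ ∉ onesLabels o b := fun hm =>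
      lt_irrefl _ (ho _ (onesLabels_subset_labels o b hm))
    rintro (_ | ⟨_ | _, b⟩) hb (_ | ⟨_ | _, c⟩) hc hbc <;>
      simp only [Set.mem_ofPred_eq, run, Bool.false_eq_true, onesLabels] at hb hc hbc
    · rw [ihz oz hb hc hbc]
    · exact absurd (by simp [hbc]) (notMem_z b)
    · exact absurd (by simp [← hbc]) (notMem_z c)
    · have key := congrArg (Finset.erase · ℓ) hbc
      simp only [← Finset.insert_eq, Finset.erase_insert (notMem_o _)] at key
      rw [iho oo hb hc key]

theorem stmt_5 (v : Z) (h : Ordered v) :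
    Set.BijOn (fun b => onesLabels v b) {b : List Bool | run v b = true} ↑(F v) := by
  refine ⟨fun b hb => (mem_F_iff v _).2 ⟨b, hb, rfl⟩, onesLabels_injOn v h, fun S hS => ?_⟩
  exact (mem_F_iff v S).1 hS
end
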